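/- Let A be a unital algebra (a graded algebra concentrated in degree zero) over a commutative ring K equipped with a double quasi-Poisson bracket ⟪−,−⟫, and let v be a cyclic bilinear form on a counital coalgebra M. Then the restriction of the induced bracket ⟨−,−⟩_v⁺ on A_M⁺ to the subalgebra E = (A_M⁺)^{M̲*} satisfies the Jacobi identity, so that (E, ⟨−,−⟩_v⁺) is a Poisson algebra. In fact, the Jacobi form of ⟨−,−⟩_v⁺ vanishes on E × A_M⁺ × A_M⁺. -/

import Mathlib

open TensorProduct

namespace PG

variable {K : Type} [CommRing K]

section Coalgebra

variable {M : Type} [AddCommGroup M] [Module K M]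

/-- Coassociativity of a comultiplication `μ : M → M ⊗ M`. -/
def Coassoc (μ : M →ₗ[K] M ⊗[K] M) : Prop :=
  (TensorProduct.assoc K M M M).toLinearMap ∘ₗ (μ.rTensor M) ∘ₗ μ = (μ.lTensor M) ∘ₗ μ

/-- The iterated comultiplication `μ² : M → M ⊗ (M ⊗ M)`. -/
noncomputable def comul2 (μ : M →ₗ[K] M ⊗[K] M) : M →ₗ[K] M ⊗[K] (M ⊗[K] M) :=
  (μ.lTensor M) ∘ₗ μ

/-- The flip `p₂₁ : M ⊗ M → M ⊗ M`. -/
noncomputable def flipT (K M : Type) [CommRing K] [AddCommGroup M] [Module K M] :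
    M ⊗[K] M →ₗ[K] M ⊗[K] M :=
  (TensorProduct.comm K M M).toLinearMap

/-- The map `v̂ : M ⊗ M → M ⊗ M`, `v̂(α ⊗ β) = v(α ⊗ β²) β¹ ⊗ β³`, associated with a
bilinear form `v` on a coalgebra `(M, μ)`. -/
noncomputable def hat (μ : M →ₗ[K] M ⊗[K] M) (v : M ⊗[K] M →ₗ[K] K) :
    M ⊗[K] M →ₗ[K] M ⊗[K] M :=
  (LinearMap.lTensor M (TensorProduct.lid K M).toLinearMap)
  ∘ₗ (LinearMap.lTensor M (LinearMap.rTensor M v))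
  ∘ₗ (LinearMap.lTensor M (TensorProduct.assoc K M M M).symm.toLinearMap)
  ∘ₗ (TensorProduct.assoc K M M (M ⊗[K] M)).toLinearMap
  ∘ₗ (LinearMap.rTensor (M ⊗[K] M) (TensorProduct.comm K M M).toLinearMap)
  ∘ₗ (TensorProduct.assoc K M M (M ⊗[K] M)).symm.toLinearMap
  ∘ₗ (LinearMap.lTensor M (comul2 μ))

/-- A bilinear form `v` on a coalgebra `(M, μ)` is cyclic if `v̂` commutes with the flip. -/
noncomputable def IsCyclic (μ : M →ₗ[K] M ⊗[K] M) (v : M ⊗[K] M →ₗ[K] K) : Prop :=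
  (hat μ v) ∘ₗ flipT K M = flipT K M ∘ₗ (hat μ v)

/-- `ε : M → K` is a counit for the comultiplication `μ`. -/
def IsCounit (μ : M →ₗ[K] M ⊗[K] M) (ε : M →ₗ[K] K) : Prop :=
  ∀ α : M, (TensorProduct.lid K M) ((ε.rTensor M) (μ α)) = α ∧
    (TensorProduct.rid K M) ((ε.lTensor M) (μ α)) = α

/-- The convolution product on the dual of a coalgebra: `(f * g)(α) = f(α¹) g(α²)`. -/
noncomputable def conv (μ : M →ₗ[K] M ⊗[K] M) (f g : M →ₗ[K] K) : M →ₗ[K] K :=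
  (LinearMap.mul' K K) ∘ₗ (TensorProduct.map f g) ∘ₗ μ

/-- The inner action `α ↦ w(α¹) α² u(α³)` of a pair of dual elements on a coalgebra
(for `w = u⁻¹`, this is the inner automorphism `ᵘα`). -/
noncomputable def innerAct (μ : M →ₗ[K] M ⊗[K] M) (w u : M →ₗ[K] K) : M →ₗ[K] M :=
  (TensorProduct.rid K M).toLinearMap
  ∘ₗ (TensorProduct.lid K (M ⊗[K] K)).toLinearMap
  ∘ₗ (TensorProduct.map w (LinearMap.lTensor M u))
  ∘ₗ (LinearMap.lTensor M μ) ∘ₗ μ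

/-- The inner coderivation `δ_φ(α) = φ(α²) α¹ − φ(α¹) α²` associated with `φ ∈ M*`. -/
noncomputable def innerCoder (μ : M →ₗ[K] M ⊗[K] M) (φ : M →ₗ[K] K) : M →ₗ[K] M :=
  ((TensorProduct.rid K M).toLinearMap ∘ₗ (LinearMap.lTensor M φ) ∘ₗ μ)
  - ((TensorProduct.lid K M).toLinearMap ∘ₗ (φ.rTensor M) ∘ₗ μ)

/-- A coderivation of the coalgebra `(M, μ)`. -/
def IsCoderivation (μ : M →ₗ[K] M ⊗[K] M) (δ : M →ₗ[K] M) : Prop :=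
  μ ∘ₗ δ = (δ.rTensor M + δ.lTensor M) ∘ₗ μ

/-- `D ⊗ id` as an endomorphism of `N ⊗ (N ⊗ N)`, for an endomorphism `D` of `N ⊗ N`. -/
noncomputable def tend12 {N : Type} [AddCommGroup N] [Module K N]
    (D : N ⊗[K] N →ₗ[K] N ⊗[K] N) :
    N ⊗[K] (N ⊗[K] N) →ₗ[K] N ⊗[K] (N ⊗[K] N) :=
  (TensorProduct.assoc K N N N).toLinearMap ∘ₗ (LinearMap.rTensor N D)
    ∘ₗ (TensorProduct.assoc K N N N).symm.toLinearMap

end Coalgebra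

end PG
namespace PG

/-- The sign `(−1)^m` for an integer `m`. -/
def sgn (m : ℤ) : ℤ := (((-1 : ℤˣ) ^ m : ℤˣ) : ℤ)

section Graded

variable {K : Type} [CommRing K]
variable {A : Type} [NonUnitalRing A] [Module K A] [SMulCommClass K A A] [IsScalarTower K A A]

/-- The graded (signed) flip `a ⊗ b ↦ (−1)^{(|a|+n)(|b|+n)} b ⊗ a` on `A ⊗ A`,
for a `ℤ`-graded algebra `(A, 𝒜)`. -/
noncomputable def gflip (𝒜 : ℤ → Submodule K A) [DirectSum.Decomposition 𝒜] (n : ℤ) :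
    A ⊗[K] A →ₗ[K] A ⊗[K] A :=
  (DirectSum.toModule K (ℤ × ℤ) (A ⊗[K] A) fun pq =>
      sgn ((pq.1 + n) * (pq.2 + n)) •
        ((TensorProduct.map (𝒜 pq.2).subtype (𝒜 pq.1).subtype) ∘ₗ
          (TensorProduct.comm K (𝒜 pq.1) (𝒜 pq.2)).toLinearMap))
  ∘ₗ (TensorProduct.directSum K K (fun p : ℤ => 𝒜 p) (fun q : ℤ => 𝒜 q)).toLinearMap
  ∘ₗ (TensorProduct.map (DirectSum.decomposeLinearEquiv 𝒜).toLinearMap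
        (DirectSum.decomposeLinearEquiv 𝒜).toLinearMap)

/-- The degree-`s` part of `A ⊗ A`: the sum of the images of `𝒜 i ⊗ 𝒜 j` with `i + j = s`. -/
noncomputable def grade2 (𝒜 : ℤ → Submodule K A) (s : ℤ) : Submodule K (A ⊗[K] A) :=
  ⨆ i : ℤ, LinearMap.range (TensorProduct.map (𝒜 i).subtype (𝒜 (s - i)).subtype)

/-- An `n`-graded double bracket on a graded algebra `(A, 𝒜)`, given as a bilinear map
`db : A → A → A ⊗ A`: the grading condition, the `n`-graded antisymmetry
`⟪−,−⟫ ∘ P₂₁,ₙ = −P₂₁ ∘ ⟪−,−⟫`, and the `n`-graded Leibniz rule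
`⟪a,bc⟫ = ⟪a,b⟫c + (−1)^{|a|ₙ|b|} b⟪a,c⟫`. -/
structure IsDoubleBracket (𝒜 : ℤ → Submodule K A) [DirectSum.Decomposition 𝒜] (n : ℤ)
    (db : A →ₗ[K] A →ₗ[K] A ⊗[K] A) : Prop where
  grading : ∀ (p q : ℤ) (a b : A), a ∈ 𝒜 p → b ∈ 𝒜 q →
    db a b ∈ grade2 𝒜 (p + q + n)
  antisymm : ∀ (p q : ℤ) (a b : A), a ∈ 𝒜 p → b ∈ 𝒜 q →
    sgn ((p + n) * (q + n)) • db b a = - gflip 𝒜 0 (db a b)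
  leibniz : ∀ (p q : ℤ) (a b c : A), a ∈ 𝒜 p → b ∈ 𝒜 q →
    db a (b * c) = (LinearMap.lTensor A (LinearMap.mulRight K c)) (db a b)
      + sgn ((p + n) * q) • (LinearMap.rTensor A (LinearMap.mulLeft K b)) (db a c)

variable (𝒜 : ℤ → Submodule K A) [DirectSum.Decomposition 𝒜]

/-- The `n`-graded cyclic permutation `P₃₁₂,ₙ = (P₂₁,ₙ ⊗ id) ∘ (id ⊗ P₂₁,ₙ)` on `A ⊗ (A ⊗ A)`. -/
noncomputable def P312 (n : ℤ) : A ⊗[K] (A ⊗[K] A) →ₗ[K] A ⊗[K] (A ⊗[K] A) :=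
  tend12 (gflip 𝒜 n) ∘ₗ LinearMap.lTensor A (gflip 𝒜 n)

/-- The `n`-graded cyclic permutation `P₂₃₁,ₙ = (id ⊗ P₂₁,ₙ) ∘ (P₂₁,ₙ ⊗ id)`, which is the
inverse of `P₃₁₂,ₙ`. -/
noncomputable def P231 (n : ℤ) : A ⊗[K] (A ⊗[K] A) →ₗ[K] A ⊗[K] (A ⊗[K] A) :=
  LinearMap.lTensor A (gflip 𝒜 n) ∘ₗ tend12 (gflip 𝒜 n)

/-- The tribracket `⟪−,−,−⟫ = Σ_{i=0}^{2} P₃₁₂^i (⟪−,−⟫⊗id)(id⊗⟪−,−⟫) P₃₁₂,ₙ^{−i}` induced by an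
`n`-graded double bracket. -/
noncomputable def tribracket (n : ℤ) (db : A →ₗ[K] A →ₗ[K] A ⊗[K] A) :
    A ⊗[K] (A ⊗[K] A) →ₗ[K] A ⊗[K] (A ⊗[K] A) :=
  letI D := TensorProduct.lift db
  letI T := tend12 D ∘ₗ LinearMap.lTensor A D
  T + P312 𝒜 0 ∘ₗ T ∘ₗ P231 𝒜 n
    + P312 𝒜 0 ∘ₗ P312 𝒜 0 ∘ₗ T ∘ₗ P231 𝒜 n ∘ₗ P231 𝒜 n

/-- The submodule `[A,A]` of a graded algebra, spanned by the graded commutators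
`ab − (−1)^{|a||b|} ba` of homogeneous elements. -/
noncomputable def gradedCommutator (𝒜' : ℤ → Submodule K A) : Submodule K A :=
  Submodule.span K {x : A | ∃ (p q : ℤ) (a b : A),
    a ∈ 𝒜' p ∧ b ∈ 𝒜' q ∧ x = a * b - sgn (p * q) • (b * a)}

end Graded

end PG
namespace PG

section RepAlg

variable {K : Type} [CommRing K]
variable {A : Type} [NonUnitalRing A] [Module K A] [SMulCommClass K A A] [IsScalarTower K A A]
variable {M : Type} [AddCommGroup M] [Module K M]
variable {R : Type} [NonUnitalRing R] [Module K R] [SMulCommClass K R R] [IsScalarTower K R R]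

/-- The multiplicativity relation `(ab)_α = a_{α¹} b_{α²}` for a bilinear family
`ρ : A → M → R` of elements of an algebra `R`. -/
def MulRel (μ : M →ₗ[K] M ⊗[K] M) (ρ : A →ₗ[K] M →ₗ[K] R) : Prop :=
  ∀ (a b : A) (α : M),
    ρ (a * b) α = LinearMap.mul' K R (TensorProduct.map (ρ a) (ρ b) (μ α))

/-- The grading condition: `a_α` is homogeneous of degree `|a|`. -/
def GradRel (𝒜 : ℤ → Submodule K A) (ℛ : ℤ → Submodule K R) (ρ : A →ₗ[K] M →ₗ[K] R) : Prop :=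
  ∀ (p : ℤ) (a : A), a ∈ 𝒜 p → ∀ α : M, ρ a α ∈ ℛ p

/-- The generation condition: the symbols `a_α` generate `R` as a (non-unital) algebra. -/
def GenRel (ρ : A →ₗ[K] M →ₗ[K] R) : Prop :=
  NonUnitalAlgebra.adjoin K {x : R | ∃ (a : A) (α : M), ρ a α = x} = ⊤

/-- The universal property of the representation algebra `A_M` among commutative graded
algebras: any bilinear family satisfying the grading and multiplicativity relations in a
commutative graded algebra `B` is induced by a unique graded algebra homomorphism `R → B`. -/
def UnivRelComm (μ : M →ₗ[K] M ⊗[K] M) (𝒜 : ℤ → Submodule K A) (ℛ : ℤ → Submodule K R)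
    (ρ : A →ₗ[K] M →ₗ[K] R) : Prop :=
  ∀ (B : Type) [NonUnitalCommRing B] [Module K B] [SMulCommClass K B B] [IsScalarTower K B B],
  ∀ (ℬ : ℤ → Submodule K B) (σ : A →ₗ[K] M →ₗ[K] B),
    GradRel 𝒜 ℬ σ → MulRel μ σ →
    ∃! F : R →ₙₐ[K] B, (∀ (p : ℤ) (x : R), x ∈ ℛ p → F x ∈ ℬ p) ∧
      ∀ (a : A) (α : M), F (ρ a α) = σ a α

/-- The universal property of the algebra `Ã_M` among all graded algebras. -/
def UnivRelNC (μ : M →ₗ[K] M ⊗[K] M) (𝒜 : ℤ → Submodule K A) (ℛ : ℤ → Submodule K R)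
    (ρ : A →ₗ[K] M →ₗ[K] R) : Prop :=
  ∀ (B : Type) [NonUnitalRing B] [Module K B] [SMulCommClass K B B] [IsScalarTower K B B],
  ∀ (ℬ : ℤ → Submodule K B) (σ : A →ₗ[K] M →ₗ[K] B),
    GradRel 𝒜 ℬ σ → MulRel μ σ →
    ∃! F : R →ₙₐ[K] B, (∀ (p : ℤ) (x : R), x ∈ ℛ p → F x ∈ ℬ p) ∧
      ∀ (a : A) (α : M), F (ρ a α) = σ a α

/-- `(R, ℛ, ρ)` is the representation algebra `A_M` of the graded algebra `(A, 𝒜)` with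
respect to the coalgebra `(M, μ)`: `R` is commutative, the symbols `ρ a α = a_α` satisfy
the defining relations of `A_M`, generate `R`, and `R` has the universal property. -/
structure IsRepAlgebra (μ : M →ₗ[K] M ⊗[K] M) (𝒜 : ℤ → Submodule K A)
    (ℛ : ℤ → Submodule K R) (ρ : A →ₗ[K] M →ₗ[K] R) : Prop where
  comm : ∀ x y : R, x * y = y * x
  mul_rel : MulRel μ ρ
  grad_rel : GradRel 𝒜 ℛ ρ
  gen_rel : GenRel ρ
  univ_rel : UnivRelComm μ 𝒜 ℛ ρ

/-- `(S, 𝒮, ρ)` is the algebra `Ã_M` of the graded algebra `(A, 𝒜)` with respect to the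
coalgebra `(M, μ)`. -/
structure IsTildeRepAlgebra (μ : M →ₗ[K] M ⊗[K] M) (𝒜 : ℤ → Submodule K A)
    (ℛ : ℤ → Submodule K R) (ρ : A →ₗ[K] M →ₗ[K] R) : Prop where
  mul_rel : MulRel μ ρ
  grad_rel : GradRel 𝒜 ℛ ρ
  gen_rel : GenRel ρ
  univ_rel : UnivRelNC μ 𝒜 ℛ ρ

/-- The pairing `(A ⊗ A) ⊗ (M ⊗ M) → R`, `(x ⊗ y) ⊗ (γ ⊗ δ) ↦ x_γ · y_δ`. -/
noncomputable def pair2 (ρ : A →ₗ[K] M →ₗ[K] R) :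
    (A ⊗[K] A) ⊗[K] (M ⊗[K] M) →ₗ[K] R :=
  (LinearMap.mul' K R) ∘ₗ (TensorProduct.map (TensorProduct.lift ρ) (TensorProduct.lift ρ))
    ∘ₗ (TensorProduct.tensorTensorTensorComm K A A M M).toLinearMap

/-- The pairing `(A ⊗ (A ⊗ A)) ⊗ (M ⊗ (M ⊗ M)) → R`,
`(x ⊗ (y ⊗ z)) ⊗ (γ ⊗ (δ ⊗ η)) ↦ x_γ · (y_δ · z_η)`. -/
noncomputable def pair3 (ρ : A →ₗ[K] M →ₗ[K] R) :
    (A ⊗[K] (A ⊗[K] A)) ⊗[K] (M ⊗[K] (M ⊗[K] M)) →ₗ[K] R :=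
  (LinearMap.mul' K R) ∘ₗ (TensorProduct.map (TensorProduct.lift ρ) (pair2 ρ))
    ∘ₗ (TensorProduct.tensorTensorTensorComm K A (A ⊗[K] A) M (M ⊗[K] M)).toLinearMap

/-- An `n`-graded biderivation on a graded algebra `(R, ℛ)`. -/
structure IsBider (ℛ : ℤ → Submodule K R) (n : ℤ) (br : R →ₗ[K] R →ₗ[K] R) : Prop where
  grading : ∀ (p q : ℤ) (x y : R), x ∈ ℛ p → y ∈ ℛ q → br x y ∈ ℛ (p + q + n)
  antisymm : ∀ (p q : ℤ) (x y : R), x ∈ ℛ p → y ∈ ℛ q →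
    br x y = - (sgn ((p + n) * (q + n)) • br y x)
  leibniz : ∀ (p q : ℤ) (x y : R), x ∈ ℛ p → y ∈ ℛ q → ∀ z : R,
    br x (y * z) = br x y * z + sgn ((p + n) * q) • (y * br x z)

/-- The defining formula `⟨a_α, b_β⟩_v = v(α ⊗ β²) ⟪a,b⟫′_{β¹} ⟪a,b⟫″_{β³}` of the bracket
induced on the representation algebra by a double bracket `db` and a bilinear form `v`. -/
noncomputable def BrFormula (μ : M →ₗ[K] M ⊗[K] M) (v : M ⊗[K] M →ₗ[K] K)
    (db : A →ₗ[K] A →ₗ[K] A ⊗[K] A) (ρ : A →ₗ[K] M →ₗ[K] R)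
    (br : R →ₗ[K] R →ₗ[K] R) : Prop :=
  ∀ (a b : A) (α β : M),
    br (ρ a α) (ρ b β) = pair2 ρ ((db a b) ⊗ₜ[K] (hat μ v (α ⊗ₜ[K] β)))

/-- A degree-zero derivation of a graded algebra `(R, ℛ)`. -/
def IsGDer (ℛ : ℤ → Submodule K R) (D : R →ₗ[K] R) : Prop :=
  (∀ (p : ℤ) (x : R), x ∈ ℛ p → D x ∈ ℛ p) ∧ ∀ x y : R, D (x * y) = D x * y + x * D y

/-- The Jacobi form of an `n`-graded bracket, evaluated on elements of degrees `p, q, r`. -/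
noncomputable def jacobiForm (n : ℤ) (br : R →ₗ[K] R →ₗ[K] R) (p q r : ℤ) (x y z : R) : R :=
  sgn ((p + n) * (r + n)) • br x (br y z) + sgn ((q + n) * (p + n)) • br y (br z x)
    + sgn ((r + n) * (q + n)) • br z (br x y)

/-- The fixed-point set `A_M^U` of the action of the group `U(M*)` of invertible elements of
the dual algebra `M*` on `R = A_M` (given by `u · a_α = a_{ᵘα}` on generators). -/
def fixUSet (μ : M →ₗ[K] M ⊗[K] M) (ε : M →ₗ[K] K) (ρ : A →ₗ[K] M →ₗ[K] R) : Set R :=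
  {x : R | ∀ u w : M →ₗ[K] K, conv μ u w = ε → conv μ w u = ε →
    ∀ F : R →ₙₐ[K] R, (∀ (a : A) (α : M), F (ρ a α) = ρ a (innerAct μ w u α)) → F x = x}

/-- The set `A_M^M` of elements of `R = A_M` annihilated by the derivations induced by all
inner coderivations `δ_φ`, `φ ∈ M*`. -/
def fixMSet (μ : M →ₗ[K] M ⊗[K] M) (ℛ : ℤ → Submodule K R) (ρ : A →ₗ[K] M →ₗ[K] R) : Set R :=
  {x : R | ∀ φ : M →ₗ[K] K, ∀ D : R →ₗ[K] R, IsGDer ℛ D →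
    (∀ (a : A) (α : M), D (ρ a α) = ρ a (innerCoder μ φ α)) → D x = 0}

end RepAlg

end PG
namespace PG

section Plus

variable {K : Type} [CommRing K]
variable {A : Type} [NonUnitalRing A] [Module K A] [SMulCommClass K A A] [IsScalarTower K A A]
variable {M : Type} [AddCommGroup M] [Module K M]
variable {B : Type} [NonUnitalRing B] [Module K B] [SMulCommClass K B B] [IsScalarTower K B B]

/-- The grading condition on a linear map `s : A → Hom(M, B)` into the convolution algebra. -/
def ConvGrad (𝒜 : ℤ → Submodule K A) (ℬ : ℤ → Submodule K B)
    (s : A →ₗ[K] M →ₗ[K] B) : Prop :=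
  ∀ (p : ℤ) (a : A), a ∈ 𝒜 p → ∀ m : M, s a m ∈ ℬ p

/-- Multiplicativity of `s : A → Hom(M, B)` with respect to the convolution product
`f₁ f₂ = m_B ∘ (f₁ ⊗ f₂) ∘ μ` on `Hom(M, B)`. -/
def ConvMul (μ : M →ₗ[K] M ⊗[K] M) (s : A →ₗ[K] M →ₗ[K] B) : Prop :=
  ∀ a b : A, s (a * b) = (LinearMap.mul' K B) ∘ₗ (TensorProduct.map (s a) (s b)) ∘ₗ μ

end Plus

section RepPlus

variable {K : Type} [CommRing K]
variable {A : Type} [Ring A] [Algebra K A]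
variable {M : Type} [AddCommGroup M] [Module K M]
variable {R : Type} [CommRing R] [Algebra K R]

/-- The universal property of the unital representation algebra `A⁺_M` among unital
commutative graded algebras. -/
def UnivRelPlus (μ : M →ₗ[K] M ⊗[K] M) (ε : M →ₗ[K] K) (𝒜 : ℤ → Submodule K A)
    (ℛ : ℤ → Submodule K R) (ρ : A →ₗ[K] M →ₗ[K] R) : Prop :=
  ∀ (B : Type) [CommRing B] [Algebra K B],
  ∀ (ℬ : ℤ → Submodule K B) (σ : A →ₗ[K] M →ₗ[K] B),
    GradRel 𝒜 ℬ σ → MulRel μ σ → (∀ α : M, σ 1 α = ε α • (1 : B)) →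
    ∃! F : R →ₐ[K] B, (∀ (p : ℤ) (x : R), x ∈ ℛ p → F x ∈ ℬ p) ∧
      ∀ (a : A) (α : M), F (ρ a α) = σ a α

/-- `(R, ℛ, ρ)` is the unital representation algebra `A⁺_M` of a unital graded algebra
`(A, 𝒜)` with respect to a counital coalgebra `(M, μ, ε)`. -/
structure IsRepAlgebraPlus (μ : M →ₗ[K] M ⊗[K] M) (ε : M →ₗ[K] K)
    (𝒜 : ℤ → Submodule K A) (ℛ : ℤ → Submodule K R) (ρ : A →ₗ[K] M →ₗ[K] R) : Prop where
  mul_rel : MulRel μ ρ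
  grad_rel : GradRel 𝒜 ℛ ρ
  norm_rel : ∀ α : M, ρ 1 α = ε α • (1 : R)
  gen_rel : Algebra.adjoin K {x : R | ∃ (a : A) (α : M), ρ a α = x} = ⊤
  univ_rel : UnivRelPlus μ ε 𝒜 ℛ ρ

/-- The universal property of the unital algebra `Ã⁺_M` among all unital graded algebras. -/
def UnivRelPlusNC {S : Type} [Ring S] [Algebra K S] (μ : M →ₗ[K] M ⊗[K] M) (ε : M →ₗ[K] K)
    (𝒜 : ℤ → Submodule K A) (𝒮 : ℤ → Submodule K S) (ρ : A →ₗ[K] M →ₗ[K] S) : Prop :=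
  ∀ (B : Type) [Ring B] [Algebra K B],
  ∀ (ℬ : ℤ → Submodule K B) (σ : A →ₗ[K] M →ₗ[K] B),
    GradRel 𝒜 ℬ σ → MulRel μ σ → (∀ α : M, σ 1 α = ε α • (1 : B)) →
    ∃! F : S →ₐ[K] B, (∀ (p : ℤ) (x : S), x ∈ 𝒮 p → F x ∈ ℬ p) ∧
      ∀ (a : A) (α : M), F (ρ a α) = σ a α

/-- `(S, 𝒮, ρ)` is the unital algebra `Ã⁺_M` of a unital graded algebra `(A, 𝒜)` with
respect to a counital coalgebra `(M, μ, ε)`. -/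
structure IsTildeRepAlgebraPlus {S : Type} [Ring S] [Algebra K S] (μ : M →ₗ[K] M ⊗[K] M)
    (ε : M →ₗ[K] K) (𝒜 : ℤ → Submodule K A) (𝒮 : ℤ → Submodule K S)
    (ρ : A →ₗ[K] M →ₗ[K] S) : Prop where
  mul_rel : MulRel μ ρ
  grad_rel : GradRel 𝒜 𝒮 ρ
  norm_rel : ∀ α : M, ρ 1 α = ε α • (1 : S)
  gen_rel : Algebra.adjoin K {x : S | ∃ (a : A) (α : M), ρ a α = x} = ⊤
  univ_rel : UnivRelPlusNC μ ε 𝒜 𝒮 ρ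

end RepPlus

section Ungraded

variable {K : Type} [CommRing K]
variable {A : Type} [Ring A] [Algebra K A]
variable {M : Type} [AddCommGroup M] [Module K M]
variable {R : Type} [CommRing R] [Algebra K R]

/-- The (ungraded) cyclic permutation `P₃₁₂` on `A ⊗ (A ⊗ A)`. -/
noncomputable def P312₀ (K A : Type) [CommRing K] [AddCommGroup A] [Module K A] :
    A ⊗[K] (A ⊗[K] A) →ₗ[K] A ⊗[K] (A ⊗[K] A) :=
  tend12 (flipT K A) ∘ₗ LinearMap.lTensor A (flipT K A)

/-- The (ungraded) cyclic permutation `P₂₃₁ = P₃₁₂⁻¹` on `A ⊗ (A ⊗ A)`. -/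
noncomputable def P231₀ (K A : Type) [CommRing K] [AddCommGroup A] [Module K A] :
    A ⊗[K] (A ⊗[K] A) →ₗ[K] A ⊗[K] (A ⊗[K] A) :=
  LinearMap.lTensor A (flipT K A) ∘ₗ tend12 (flipT K A)

/-- The tribracket `⟪−,−,−⟫ = Σ_{i=0}^{2} P₃₁₂^i (⟪−,−⟫⊗id)(id⊗⟪−,−⟫) P₃₁₂^{−i}` induced by a
double bracket on a non-graded algebra. -/
noncomputable def tribracket₀ (db : A →ₗ[K] A →ₗ[K] A ⊗[K] A) :
    A ⊗[K] (A ⊗[K] A) →ₗ[K] A ⊗[K] (A ⊗[K] A) :=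
  letI D := TensorProduct.lift db
  letI T := tend12 D ∘ₗ LinearMap.lTensor A D
  T + P312₀ K A ∘ₗ T ∘ₗ P231₀ K A
    + P312₀ K A ∘ₗ P312₀ K A ∘ₗ T ∘ₗ P231₀ K A ∘ₗ P231₀ K A

/-- A double bracket on a non-graded unital algebra `A`: antisymmetry `⟪b,a⟫ = −P₂₁⟪a,b⟫` and
the Leibniz rule `⟪a,bc⟫ = ⟪a,b⟫c + b⟪a,c⟫`. -/
structure IsDoubleBracket₀ (db : A →ₗ[K] A →ₗ[K] A ⊗[K] A) : Prop where
  antisymm : ∀ a b : A, db b a = - flipT K A (db a b)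
  leibniz : ∀ a b c : A,
    db a (b * c) = (LinearMap.lTensor A (LinearMap.mulRight K c)) (db a b)
      + (LinearMap.rTensor A (LinearMap.mulLeft K b)) (db a c)

/-- A double bracket on a non-graded unital algebra is quasi-Poisson if its induced
tribracket is given by Van den Bergh's explicit formula. -/
def IsQuasiPoisson (db : A →ₗ[K] A →ₗ[K] A ⊗[K] A) : Prop :=
  ∀ a b c : A,
    tribracket₀ db (a ⊗ₜ[K] (b ⊗ₜ[K] c)) =
      c ⊗ₜ[K] (a ⊗ₜ[K] b) + (1 : A) ⊗ₜ[K] ((a * b) ⊗ₜ[K] c) + a ⊗ₜ[K] ((1 : A) ⊗ₜ[K] (b * c))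
        + (c * a) ⊗ₜ[K] (b ⊗ₜ[K] (1 : A)) - a ⊗ₜ[K] (b ⊗ₜ[K] c)
        - (1 : A) ⊗ₜ[K] (a ⊗ₜ[K] (b * c)) - (c * a) ⊗ₜ[K] ((1 : A) ⊗ₜ[K] b)
        - c ⊗ₜ[K] ((a * b) ⊗ₜ[K] (1 : A))

/-- The universal property of the unital representation algebra `A⁺_M` of a non-graded
unital algebra among unital commutative algebras. -/
def UnivRelPlus₀ (μ : M →ₗ[K] M ⊗[K] M) (ε : M →ₗ[K] K)
    (ρ : A →ₗ[K] M →ₗ[K] R) : Prop :=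
  ∀ (B : Type) [CommRing B] [Algebra K B],
  ∀ σ : A →ₗ[K] M →ₗ[K] B,
    MulRel μ σ → (∀ α : M, σ 1 α = ε α • (1 : B)) →
    ∃! F : R →ₐ[K] B, ∀ (a : A) (α : M), F (ρ a α) = σ a α

/-- `(R, ρ)` is the unital representation algebra `A⁺_M` of a non-graded unital algebra `A`
with respect to a counital coalgebra `(M, μ, ε)`. -/
structure IsRepAlgebraPlus₀ (μ : M →ₗ[K] M ⊗[K] M) (ε : M →ₗ[K] K)
    (ρ : A →ₗ[K] M →ₗ[K] R) : Prop where
  mul_rel : MulRel μ ρ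
  norm_rel : ∀ α : M, ρ 1 α = ε α • (1 : R)
  gen_rel : Algebra.adjoin K {x : R | ∃ (a : A) (α : M), ρ a α = x} = ⊤
  univ_rel : UnivRelPlus₀ μ ε ρ

end Ungraded

end PG
namespace PGaux

open PG WithConv

section

variable {K A M R : Type} [CommRing K] [Ring A] [Algebra K A]
  [AddCommGroup M] [Module K M] [Coalgebra K M] [CommRing R] [Algebra K R]

/-- Scalar functionals viewed in the convolution algebra. -/
noncomputable def emb (R : Type) [CommRing R] [Algebra K R] (f : M →ₗ[K] K) :
    WithConv (M →ₗ[K] R) :=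
  toConv (Algebra.linearMap K R ∘ₗ f)

/-- The functional `v(α ⊗ -)` in the convolution algebra. -/
noncomputable def V (R : Type) [CommRing R] [Algebra K R] (v : M ⊗[K] M →ₗ[K] K) (α : M) :
    WithConv (M →ₗ[K] R) :=
  emb R (v ∘ₗ TensorProduct.mk K M M α)

/-- The family `ρ` with values in the convolution algebra. -/
noncomputable def rc (ρ : A →ₗ[K] M →ₗ[K] R) : A →ₗ[K] WithConv (M →ₗ[K] R) where
  toFun a := toConv (ρ a)
  map_add' a b := by simp
  map_smul' a b := by simp

/-- Composition with a linear map. -/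
noncomputable def dc (D : R →ₗ[K] R) (f : WithConv (M →ₗ[K] R)) : WithConv (M →ₗ[K] R) :=
  toConv (D ∘ₗ f.ofConv)

/-- `x ⊗ y ↦ x u y`. -/
noncomputable def Phi2 (ρ : A →ₗ[K] M →ₗ[K] R) (u : WithConv (M →ₗ[K] R)) :
    A ⊗[K] A →ₗ[K] WithConv (M →ₗ[K] R) :=
  LinearMap.mul' K (WithConv (M →ₗ[K] R)) ∘ₗ
    TensorProduct.map (LinearMap.mulRight K u ∘ₗ rc ρ) (rc ρ)

/-- `x ⊗ y ⊗ z ↦ x u y w z`. -/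
noncomputable def Psi3 (ρ : A →ₗ[K] M →ₗ[K] R) (u w : WithConv (M →ₗ[K] R)) :
    A ⊗[K] (A ⊗[K] A) →ₗ[K] WithConv (M →ₗ[K] R) :=
  LinearMap.mul' K (WithConv (M →ₗ[K] R)) ∘ₗ
    TensorProduct.map (LinearMap.mulRight K u ∘ₗ rc ρ) (Phi2 ρ w)

lemma Phi2_tmul (ρ : A →ₗ[K] M →ₗ[K] R) (u : WithConv (M →ₗ[K] R)) (x y : A) :
    Phi2 ρ u (x ⊗ₜ y) = rc ρ x * u * rc ρ y := by
  simp [Phi2]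

lemma Psi3_tmul (ρ : A →ₗ[K] M →ₗ[K] R) (u w : WithConv (M →ₗ[K] R)) (x y z : A) :
    Psi3 ρ u w (x ⊗ₜ (y ⊗ₜ z)) = rc ρ x * u * rc ρ y * w * rc ρ z := by
  simp [Psi3, Phi2, mul_assoc]

lemma Psi3_assoc (ρ : A →ₗ[K] M →ₗ[K] R) (u w : WithConv (M →ₗ[K] R)) (s : A ⊗[K] A) (z : A) :
    Psi3 ρ u w (TensorProduct.assoc K A A A (s ⊗ₜ z)) = Phi2 ρ u s * w * rc ρ z := by
  induction s with
  | zero => simp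
  | add p q hp hq => simp only [TensorProduct.add_tmul, map_add, hp, hq, add_mul]
  | tmul x y => rw [TensorProduct.assoc_tmul, Psi3_tmul, Phi2_tmul]

/-- triple evaluation -/
noncomputable def ev3 (f g h : WithConv (M →ₗ[K] R)) : M ⊗[K] (M ⊗[K] M) →ₗ[K] R :=
  LinearMap.mul' K R ∘ₗ TensorProduct.map f.ofConv
    (LinearMap.mul' K R ∘ₗ TensorProduct.map g.ofConv h.ofConv)

lemma mul3_apply (f g h : WithConv (M →ₗ[K] R)) (β : M) :
    (f * g * h) β = ev3 f g h (comul2 Coalgebra.comul β) := by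
  rw [mul_assoc]
  change LinearMap.mul' K R (TensorProduct.map f.ofConv (g * h).ofConv (Coalgebra.comul β)) = _
  simp only [ev3, comul2, LinearMap.comp_apply]
  congr 1
  generalize (Coalgebra.comul β : M ⊗[K] M) = t
  induction t with
  | zero => simp
  | add p q hp hq => simp only [map_add, hp, hq]
  | tmul x y => rfl

lemma hat_eq (v : M ⊗[K] M →ₗ[K] K) (f g : WithConv (M →ₗ[K] R)) (α β : M) :
    LinearMap.mul' K R (TensorProduct.map f.ofConv g.ofConv
      (hat Coalgebra.comul v (α ⊗ₜ[K] β))) = (f * V R v α * g) β := by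
  rw [mul3_apply]
  simp only [hat, LinearMap.comp_apply, LinearMap.lTensor_tmul]
  generalize comul2 (K := K) Coalgebra.comul β = t
  induction t with
  | zero => simp
  | add p q hp hq => simp only [map_add, TensorProduct.tmul_add, hp, hq]
  | tmul x t =>
    induction t with
    | zero => simp
    | add p q hp hq => simp only [map_add, TensorProduct.tmul_add, hp, hq]
    | tmul y z =>
      simp [ev3, V, emb, Algebra.smul_def]
      ring

lemma cyc {v : M ⊗[K] M →ₗ[K] K} (hv : IsCyclic Coalgebra.comul v)
    (f g : WithConv (M →ₗ[K] R)) (α β : M) :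
    (f * V R v α * g) β = (g * V R v β * f) α := by
  rw [← hat_eq, ← hat_eq]
  have h := LinearMap.congr_fun hv (α ⊗ₜ[K] β)
  simp only [LinearMap.comp_apply, flipT, LinearEquiv.coe_coe, TensorProduct.comm_tmul] at h
  rw [h]
  generalize hat (K := K) Coalgebra.comul v (α ⊗ₜ[K] β) = t
  induction t with
  | zero => simp
  | add p q hp hq => simp only [map_add, hp, hq]
  | tmul x y => simp [mul_comm]

lemma dc_mul {D : R →ₗ[K] R} (hD : ∀ x y, D (x * y) = D x * y + x * D y)
    (f g : WithConv (M →ₗ[K] R)) : dc D (f * g) = dc D f * g + f * dc D g := by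
  ext β
  simp only [dc, LinearMap.convMul_def, ofConv_toConv, ofConv_add, LinearMap.add_apply,
    LinearMap.comp_apply]
  generalize (Coalgebra.comul β : M ⊗[K] M) = t
  induction t with
  | zero => simp
  | add p q hp hq => simp only [map_add, hp, hq]; abel
  | tmul x y => simp [hD]

lemma der_alg {D : R →ₗ[K] R} (hD : ∀ x y, D (x * y) = D x * y + x * D y) (k : K) :
    D (algebraMap K R k) = 0 := by
  have h1 : D 1 = 0 := by simpa using hD 1 1
  rw [Algebra.algebraMap_eq_smul_one, map_smul, h1, smul_zero]

lemma dc_emb {D : R →ₗ[K] R} (hD : ∀ x y, D (x * y) = D x * y + x * D y)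
    (f : M →ₗ[K] K) : dc D (emb R f) = 0 := by
  ext β
  simp [dc, emb, der_alg hD]

lemma dc_add (D : R →ₗ[K] R) (f g : WithConv (M →ₗ[K] R)) :
    dc D (f + g) = dc D f + dc D g := by
  ext; simp [dc]

lemma dc_sub (D : R →ₗ[K] R) (f g : WithConv (M →ₗ[K] R)) :
    dc D (f - g) = dc D f - dc D g := by
  ext; simp [dc]

lemma rc_mul {ρ : A →ₗ[K] M →ₗ[K] R} (h : MulRel Coalgebra.comul ρ) (a b : A) :
    rc ρ (a * b) = rc ρ a * rc ρ b := by
  ext β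
  exact h a b β

lemma rc_one {ρ : A →ₗ[K] M →ₗ[K] R}
    (h : ∀ α : M, ρ 1 α = Coalgebra.counit (R := K) α • (1 : R)) :
    rc ρ 1 = 1 := by
  ext β
  rw [LinearMap.convOne_apply, Algebra.algebraMap_eq_smul_one]
  exact h β

lemma der_ext {ρ : A →ₗ[K] M →ₗ[K] R}
    (hgen : Algebra.adjoin K {x : R | ∃ (a : A) (α : M), ρ a α = x} = ⊤)
    {D D' : R →ₗ[K] R} (hD : ∀ x y, D (x * y) = D x * y + x * D y)
    (hD' : ∀ x y, D' (x * y) = D' x * y + x * D' y)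
    (h : ∀ a α, D (ρ a α) = D' (ρ a α)) : D = D' := by
  ext x
  have hx : x ∈ Algebra.adjoin K {x : R | ∃ (a : A) (α : M), ρ a α = x} := by
    rw [hgen]; trivial
  induction hx using Algebra.adjoin_induction with
  | mem x hx => obtain ⟨a, α, rfl⟩ := hx; exact h a α
  | algebraMap r => rw [der_alg hD, der_alg hD']
  | add x y _ _ hx hy => rw [map_add, map_add, hx, hy]
  | mul x y _ _ hx hy => rw [hD, hD', hx, hy]

lemma pair2_tmul (ρ : A →ₗ[K] M →ₗ[K] R) (v : M ⊗[K] M →ₗ[K] K) (t : A ⊗[K] A) (α β : M) :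
    pair2 ρ (t ⊗ₜ[K] hat Coalgebra.comul v (α ⊗ₜ[K] β)) = Phi2 ρ (V R v α) t β := by
  induction t with
  | zero => simp
  | add p q hp hq => simp only [TensorProduct.add_tmul, map_add, hp, hq, ofConv_add,
      LinearMap.add_apply]
  | tmul x y =>
    rw [Phi2_tmul, ← hat_eq]
    generalize hat (K := K) Coalgebra.comul v (α ⊗ₜ[K] β) = s
    induction s with
    | zero => simp
    | add p q hp hq => simp only [TensorProduct.tmul_add, map_add, hp, hq]
    | tmul p q => simp [pair2, rc]

lemma dc_br {v : M ⊗[K] M →ₗ[K] K} {db : A →ₗ[K] A →ₗ[K] A ⊗[K] A}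
    {ρ : A →ₗ[K] M →ₗ[K] R} {br : R →ₗ[K] R →ₗ[K] R}
    (hfor : BrFormula Coalgebra.comul v db ρ br) (a b : A) (α : M) :
    dc (br (ρ a α)) (rc ρ b) = Phi2 ρ (V R v α) (db a b) := by
  ext β
  rw [← pair2_tmul]
  exact hfor a b α β

lemma tend12_tmul {db : A →ₗ[K] A →ₗ[K] A ⊗[K] A} (a x y : A) :
    tend12 (TensorProduct.lift db) (a ⊗ₜ (x ⊗ₜ y)) = TensorProduct.assoc K A A A (db a x ⊗ₜ y) := by
  simp [tend12]

lemma br_Phi {v : M ⊗[K] M →ₗ[K] K} (hv : IsCyclic Coalgebra.comul v)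
    {db : A →ₗ[K] A →ₗ[K] A ⊗[K] A}
    {ρ : A →ₗ[K] M →ₗ[K] R} {br : R →ₗ[K] R →ₗ[K] R}
    (hleib : ∀ x y z : R, br x (y * z) = br x y * z + y * br x z)
    (hfor : BrFormula Coalgebra.comul v db ρ br) (a : A) (α β γ : M) (t : A ⊗[K] A) :
    br (ρ a α) (Phi2 ρ (V R v β) t γ) =
      Psi3 ρ (V R v α) (V R v β) (tend12 (TensorProduct.lift db) (a ⊗ₜ t)) γ
      + Psi3 ρ (V R v α) (V R v γ) (tend12 (TensorProduct.lift db) (a ⊗ₜ flipT K A t)) β := by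
  induction t with
  | zero => simp
  | add p q hp hq =>
    simp only [map_add, TensorProduct.tmul_add, ofConv_add, LinearMap.add_apply, hp, hq]
    abel
  | tmul x y =>
    have hD := hleib (ρ a α)
    simp only [flipT, LinearEquiv.coe_coe, TensorProduct.comm_tmul, tend12_tmul, Psi3_assoc]
    have h1 : dc (br (ρ a α)) (Phi2 ρ (V R v β) (x ⊗ₜ y)) =
        Phi2 ρ (V R v α) (db a x) * V R v β * rc ρ y
        + rc ρ x * V R v β * Phi2 ρ (V R v α) (db a y) := by
      rw [Phi2_tmul, dc_mul hD, dc_mul hD, dc_br hfor, dc_br hfor]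
      have h0 : dc (br (ρ a α)) (V R v β) = 0 := dc_emb hD _
      rw [h0, mul_zero, add_zero]
    rw [cyc hv (Phi2 ρ (V R v α) (db a y))]
    exact congrArg (fun f => f γ) h1

/-- The basic nested term. -/
noncomputable def N (v : M ⊗[K] M →ₗ[K] K) (db : A →ₗ[K] A →ₗ[K] A ⊗[K] A)
    (ρ : A →ₗ[K] M →ₗ[K] R) (a b c : A) (α β γ : M) : R :=
  Psi3 ρ (V R v α) (V R v β) (tend12 (TensorProduct.lift db) (a ⊗ₜ db b c)) γ

lemma br_br {v : M ⊗[K] M →ₗ[K] K} (hv : IsCyclic Coalgebra.comul v)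
    {db : A →ₗ[K] A →ₗ[K] A ⊗[K] A} (hdb : IsDoubleBracket₀ db)
    {ρ : A →ₗ[K] M →ₗ[K] R} {br : R →ₗ[K] R →ₗ[K] R}
    (hleib : ∀ x y z : R, br x (y * z) = br x y * z + y * br x z)
    (hfor : BrFormula Coalgebra.comul v db ρ br) (a b c : A) (α β γ : M) :
    br (ρ a α) (br (ρ b β) (ρ c γ)) = N v db ρ a b c α β γ - N v db ρ a c b α γ β := by
  rw [hfor b c β γ, pair2_tmul, br_Phi hv hleib hfor, N, N, hdb.antisymm b c,
    TensorProduct.tmul_neg, map_neg, map_neg]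
  simp

lemma Psi3_P312 {v : M ⊗[K] M →ₗ[K] K} (hv : IsCyclic Coalgebra.comul v)
    (ρ : A →ₗ[K] M →ₗ[K] R) (t : A ⊗[K] (A ⊗[K] A)) (α β γ : M) :
    Psi3 ρ (V R v α) (V R v β) (P312₀ K A t) γ = Psi3 ρ (V R v β) (V R v γ) t α := by
  induction t with
  | zero => simp
  | add p q hp hq => simp only [map_add, ofConv_add, LinearMap.add_apply, hp, hq]
  | tmul x t =>
    induction t with
    | zero => simp
    | add p q hp hq =>
      simp only [map_add, TensorProduct.tmul_add, ofConv_add, LinearMap.add_apply, hp, hq]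
    | tmul y z =>
      have : P312₀ K A (x ⊗ₜ (y ⊗ₜ z)) = z ⊗ₜ (x ⊗ₜ y) := by simp [P312₀, tend12, flipT]
      rw [this, Psi3_tmul, Psi3_tmul]
      have := cyc hv (rc ρ z) (rc ρ x * V R v β * rc ρ y) α γ
      simpa only [mul_assoc] using this

lemma sum_N {v : M ⊗[K] M →ₗ[K] K} (hv : IsCyclic Coalgebra.comul v)
    (db : A →ₗ[K] A →ₗ[K] A ⊗[K] A)
    (ρ : A →ₗ[K] M →ₗ[K] R) (a b c : A) (α β γ : M) :
    Psi3 ρ (V R v α) (V R v β) (tribracket₀ db (a ⊗ₜ (b ⊗ₜ c))) γ =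
      N v db ρ a b c α β γ + N v db ρ b c a β γ α + N v db ρ c a b γ α β := by
  have h (x y z : A) : P231₀ K A (x ⊗ₜ (y ⊗ₜ z)) = y ⊗ₜ (z ⊗ₜ x) := by
    simp [P231₀, tend12, flipT]
  simp only [tribracket₀, LinearMap.add_apply, LinearMap.comp_apply, h, map_add, ofConv_add,
    Psi3_P312 hv, LinearMap.lTensor_tmul, TensorProduct.lift.tmul, N]

/-- The element whose inner derivation computes the quasi-Poisson tribracket. -/
noncomputable def Th (v : M ⊗[K] M →ₗ[K] K) (ρ : A →ₗ[K] M →ₗ[K] R) (b c : A) (β γ : M) :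
    WithConv (M →ₗ[K] R) :=
  1 * V R v β * (rc ρ b * V R v γ * rc ρ c) - rc ρ b * V R v β * (V R v γ * rc ρ c)
    + rc ρ b * V R v β * (rc ρ c * V R v γ) - 1 * V R v β * (rc ρ b * rc ρ c * V R v γ)

lemma tri_eq {v : M ⊗[K] M →ₗ[K] K} (hv : IsCyclic Coalgebra.comul v)
    {db : A →ₗ[K] A →ₗ[K] A ⊗[K] A} (hqp : IsQuasiPoisson db)
    {ρ : A →ₗ[K] M →ₗ[K] R} (hm : MulRel Coalgebra.comul ρ)
    (h1 : ∀ α : M, ρ 1 α = Coalgebra.counit (R := K) α • (1 : R)) (a b c : A) (α β γ : M) :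
    Psi3 ρ (V R v α) (V R v β) (tribracket₀ db (a ⊗ₜ (b ⊗ₜ c))) γ =
      (rc ρ a * Th v ρ b c β γ - Th v ρ b c β γ * rc ρ a) α := by
  have key (x y z : A) : Psi3 ρ (V R v α) (V R v β) (x ⊗ₜ (y ⊗ₜ z)) γ =
      (rc ρ y * V R v β * rc ρ z * V R v γ * rc ρ x) α := by
    rw [Psi3_tmul]
    have := cyc hv (rc ρ x) (rc ρ y * V R v β * rc ρ z) α γ
    simpa only [mul_assoc] using this
  rw [hqp]
  simp only [map_add, map_sub, ofConv_add, ofConv_sub, LinearMap.add_apply, LinearMap.sub_apply,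
    key]
  simp only [← LinearMap.add_apply, ← LinearMap.sub_apply, ← ofConv_add, ← ofConv_sub]
  congr 2
  simp only [rc_mul hm, rc_one h1, Th]
  noncomm_ring

lemma emb_comm (ρ : A →ₗ[K] M →ₗ[K] R) (φ : M →ₗ[K] K) (a : A) (α : M) :
    ρ a (innerCoder Coalgebra.comul φ α) = (rc ρ a * emb R φ - emb R φ * rc ρ a) α := by
  simp only [innerCoder, LinearMap.sub_apply, map_sub, ofConv_sub, LinearMap.comp_apply,
    LinearMap.convMul_def, ofConv_toConv]
  generalize (Coalgebra.comul α : M ⊗[K] M) = t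
  induction t with
  | zero => simp
  | add p q hp hq =>
    simp only [map_add]
    rw [add_sub_add_comm, hp, hq, add_sub_add_comm]
  | tmul x y => simp [rc, emb, Algebra.smul_def, mul_comm]

/-- Inner derivations which are realised by derivations of `R` vanishing on the invariants. -/
def Good (ρ : A →ₗ[K] M →ₗ[K] R) (E : Set R) (T : WithConv (M →ₗ[K] R)) : Prop :=
  ∃ D : R →ₗ[K] R, (∀ x y, D (x * y) = D x * y + x * D y) ∧ (∀ x ∈ E, D x = 0) ∧
    ∀ a α, D (ρ a α) = (rc ρ a * T - T * rc ρ a) α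

lemma Good.add {ρ : A →ₗ[K] M →ₗ[K] R} {E : Set R} {S T : WithConv (M →ₗ[K] R)}
    (hS : Good ρ E S) (hT : Good ρ E T) : Good ρ E (S + T) := by
  obtain ⟨D, h1, h2, h3⟩ := hS
  obtain ⟨D', h1', h2', h3'⟩ := hT
  refine ⟨D + D', fun x y => ?_, fun x hx => ?_, fun a α => ?_⟩
  · simp only [LinearMap.add_apply, h1, h1']; ring
  · simp [h2 x hx, h2' x hx]
  · rw [LinearMap.add_apply, h3, h3', ← LinearMap.add_apply, ← ofConv_add]
    congr 2
    noncomm_ring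

lemma Good.neg {ρ : A →ₗ[K] M →ₗ[K] R} {E : Set R} {S : WithConv (M →ₗ[K] R)}
    (hS : Good ρ E S) : Good ρ E (-S) := by
  obtain ⟨D, h1, h2, h3⟩ := hS
  refine ⟨-D, fun x y => ?_, fun x hx => ?_, fun a α => ?_⟩
  · simp only [LinearMap.neg_apply, h1]; ring
  · simp [h2 x hx]
  · rw [LinearMap.neg_apply, h3, ← LinearMap.neg_apply, ← ofConv_neg]
    congr 2
    noncomm_ring

lemma Good.sub {ρ : A →ₗ[K] M →ₗ[K] R} {E : Set R} {S T : WithConv (M →ₗ[K] R)}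
    (hS : Good ρ E S) (hT : Good ρ E T) : Good ρ E (S - T) := by
  rw [sub_eq_add_neg]; exact hS.add hT.neg

lemma good_emb {ρ : A →ₗ[K] M →ₗ[K] R} {E : Set R} (Dfam : (M →ₗ[K] K) → R →ₗ[K] R)
    (hDder : ∀ (φ : M →ₗ[K] K) (x y : R), Dfam φ (x * y) = Dfam φ x * y + x * Dfam φ y)
    (hDgen : ∀ (φ : M →ₗ[K] K) (a : A) (α : M),
      Dfam φ (ρ a α) = ρ a (innerCoder Coalgebra.comul φ α))
    (hE : ∀ x ∈ E, ∀ φ, Dfam φ x = 0) (r : R) (φ : M →ₗ[K] K) :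
    Good ρ E (r • emb R φ) := by
  refine ⟨LinearMap.mulLeft K r ∘ₗ Dfam φ, fun x y => ?_, fun x hx => ?_, fun a α => ?_⟩
  · simp [hDder]; ring
  · simp [hE x hx]
  · rw [LinearMap.comp_apply, hDgen, emb_comm, mul_smul_comm, smul_mul_assoc, ← smul_sub]
    rfl

lemma good_V {v : M ⊗[K] M →ₗ[K] K} (hv : IsCyclic Coalgebra.comul v)
    {ρ : A →ₗ[K] M →ₗ[K] R} {E : Set R} (Dfam : (M →ₗ[K] K) → R →ₗ[K] R)
    (hDder : ∀ (φ : M →ₗ[K] K) (x y : R), Dfam φ (x * y) = Dfam φ x * y + x * Dfam φ y)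
    (hDgen : ∀ (φ : M →ₗ[K] K) (a : A) (α : M),
      Dfam φ (ρ a α) = ρ a (innerCoder Coalgebra.comul φ α))
    (hE : ∀ x ∈ E, ∀ φ, Dfam φ x = 0) (f g : WithConv (M →ₗ[K] R)) (β : M) :
    Good ρ E (f * V R v β * g) := by
  have hg := good_emb Dfam hDder hDgen hE
  have key : ∀ t : M ⊗[K] (M ⊗[K] M), ∃ S : WithConv (M →ₗ[K] R), Good ρ E S ∧
      ∀ α, S α = ev3 g (V R v α) f t := by
    intro t
    induction t with
    | zero => exact ⟨(0 : R) • emb R 0, hg _ _, by simp⟩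
    | add p q hp hq =>
      obtain ⟨S, h1, h2⟩ := hp
      obtain ⟨T, h3, h4⟩ := hq
      exact ⟨S + T, h1.add h3, fun α => by simp [h2, h4]⟩
    | tmul x t =>
      induction t with
      | zero => exact ⟨(0 : R) • emb R 0, hg _ _, by simp⟩
      | add p q hp hq =>
        obtain ⟨S, h1, h2⟩ := hp
        obtain ⟨T, h3, h4⟩ := hq
        exact ⟨S + T, h1.add h3, fun α => by simp [h2, h4, TensorProduct.tmul_add]⟩
      | tmul y z =>
        refine ⟨(g x * f z) • emb R (v ∘ₗ (TensorProduct.mk K M M).flip y), hg _ _, fun α => ?_⟩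
        simp [ev3, V, emb]
        ring
  obtain ⟨S, h1, h2⟩ := key (comul2 Coalgebra.comul β)
  convert h1 using 1
  ext α
  rw [h2, ← mul3_apply, cyc hv]

lemma good_Th {v : M ⊗[K] M →ₗ[K] K} (hv : IsCyclic Coalgebra.comul v)
    {ρ : A →ₗ[K] M →ₗ[K] R} {E : Set R} (Dfam : (M →ₗ[K] K) → R →ₗ[K] R)
    (hDder : ∀ (φ : M →ₗ[K] K) (x y : R), Dfam φ (x * y) = Dfam φ x * y + x * Dfam φ y)
    (hDgen : ∀ (φ : M →ₗ[K] K) (a : A) (α : M),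
      Dfam φ (ρ a α) = ρ a (innerCoder Coalgebra.comul φ α))
    (hE : ∀ x ∈ E, ∀ φ, Dfam φ x = 0) (b c : A) (β γ : M) :
    Good ρ E (Th v ρ b c β γ) := by
  have hg := good_V hv Dfam hDder hDgen hE
  exact (((hg _ _ _).sub (hg _ _ _)).add (hg _ _ _)).sub (hg _ _ _)

/-- The Jacobi form, linear in its last argument. -/
noncomputable def Jc (br : R →ₗ[K] R →ₗ[K] R) (x y : R) : R →ₗ[K] R :=
  br x ∘ₗ br y + br y ∘ₗ br.flip x + br.flip (br x y)

lemma Jc_apply (br : R →ₗ[K] R →ₗ[K] R) (x y z : R) :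
    Jc br x y z = br x (br y z) + br y (br z x) + br z (br x y) := rfl

lemma Jc_der {br : R →ₗ[K] R →ₗ[K] R} (hanti : ∀ x y : R, br x y = - br y x)
    (hleib : ∀ x y z : R, br x (y * z) = br x y * z + y * br x z) (x y z w : R) :
    Jc br x y (z * w) = Jc br x y z * w + z * Jc br x y w := by
  simp only [Jc_apply]
  rw [hanti (z * w) x, hanti (z * w) (br x y), hanti z x, hanti w x, hanti z (br x y),
    hanti w (br x y)]
  simp only [hleib, map_add, map_neg]
  ring

lemma Jc_cyc (br : R →ₗ[K] R →ₗ[K] R) (x y z : R) : Jc br x y z = Jc br y z x := by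
  simp only [Jc_apply]; ring

theorem part1 {v : M ⊗[K] M →ₗ[K] K} (hv : IsCyclic Coalgebra.comul v)
    {db : A →ₗ[K] A →ₗ[K] A ⊗[K] A} (hdb : IsDoubleBracket₀ db) (hqp : IsQuasiPoisson db)
    {ρ : A →ₗ[K] M →ₗ[K] R} (hm : MulRel Coalgebra.comul ρ)
    (h1 : ∀ α : M, ρ 1 α = Coalgebra.counit (R := K) α • (1 : R))
    (hgen : Algebra.adjoin K {x : R | ∃ (a : A) (α : M), ρ a α = x} = ⊤)
    {br : R →ₗ[K] R →ₗ[K] R} (hanti : ∀ x y : R, br x y = - br y x)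
    (hleib : ∀ x y z : R, br x (y * z) = br x y * z + y * br x z)
    (hfor : BrFormula Coalgebra.comul v db ρ br)
    (Dfam : (M →ₗ[K] K) → R →ₗ[K] R)
    (hDder : ∀ (φ : M →ₗ[K] K) (x y : R), Dfam φ (x * y) = Dfam φ x * y + x * Dfam φ y)
    (hDgen : ∀ (φ : M →ₗ[K] K) (a : A) (α : M),
      Dfam φ (ρ a α) = ρ a (innerCoder Coalgebra.comul φ α))
    (x : R) (hx : ∀ φ, Dfam φ x = 0) (y z : R) : Jc br x y z = 0 := by
  have hd := Jc_der hanti hleib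
  have h0 : ∀ x y : R, (0 : R →ₗ[K] R) (x * y) = (0 : R →ₗ[K] R) x * y + x * (0 : R →ₗ[K] R) y := by
    simp
  have hbc (b c : A) (β γ : M) : Jc br (ρ b β) (ρ c γ) x = 0 := by
    have hE : ∀ y ∈ ({x} : Set R), ∀ φ, Dfam φ y = 0 := by rintro y rfl; exact hx
    obtain ⟨D, hD1, hD2, hD3⟩ := (good_Th hv Dfam hDder hDgen hE b c β γ).sub
      (good_Th hv Dfam hDder hDgen hE c b γ β)
    have : Jc br (ρ b β) (ρ c γ) = D := by
      refine der_ext hgen (hd _ _) hD1 fun a α => ?_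
      rw [← Jc_cyc, Jc_apply, br_br hv hdb hleib hfor, br_br hv hdb hleib hfor,
        br_br hv hdb hleib hfor, hD3]
      have e1 := sum_N hv db ρ a b c α β γ
      have e2 := sum_N hv db ρ a c b α γ β
      rw [tri_eq hv hqp hm h1] at e1 e2
      have : (rc ρ a * (Th v ρ b c β γ - Th v ρ c b γ β)
          - (Th v ρ b c β γ - Th v ρ c b γ β) * rc ρ a) =
          (rc ρ a * Th v ρ b c β γ - Th v ρ b c β γ * rc ρ a) -
          (rc ρ a * Th v ρ c b γ β - Th v ρ c b γ β * rc ρ a) := by noncomm_ring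
      rw [this, ofConv_sub, LinearMap.sub_apply, e1, e2]
      ring
    rw [this]
    exact hD2 x rfl
  have hb (b : A) (β : M) (z : R) : Jc br x (ρ b β) z = 0 := by
    have : Jc br x (ρ b β) = 0 := der_ext hgen (hd _ _) h0 fun c γ => by
      rw [Jc_cyc, hbc]; rfl
    rw [this]; rfl
  have : Jc br z x = 0 := der_ext hgen (hd _ _) h0 fun b β => by
    rw [Jc_cyc, hb]; rfl
  rw [← Jc_cyc, this]; rfl

lemma V_coder {v : M ⊗[K] M →ₗ[K] K} (hv : IsCyclic Coalgebra.comul v)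
    (φ : M →ₗ[K] K) (α : M) :
    V R v (innerCoder Coalgebra.comul φ α) = emb R φ * V R v α - V R v α * emb R φ := by
  ext β
  have e1 := cyc hv (emb R φ) 1 α β
  have e2 := cyc hv 1 (emb R φ) α β
  have e3 (γ : M) : V R v γ β = V R v β γ := by simpa using cyc hv 1 1 γ β
  rw [mul_one, one_mul] at e1 e2
  rw [ofConv_sub, LinearMap.sub_apply, e1, e2, e3, ← LinearMap.sub_apply, ← ofConv_sub]
  simp only [innerCoder, LinearMap.sub_apply, map_sub, ofConv_sub, LinearMap.comp_apply,
    LinearMap.convMul_def, ofConv_toConv]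
  generalize (Coalgebra.comul α : M ⊗[K] M) = t
  induction t with
  | zero => simp
  | add p q hp hq =>
    simp only [map_add]
    rw [add_sub_add_comm, hp, hq, add_sub_add_comm]
  | tmul x y => simp [emb, Algebra.smul_def, mul_comm]

theorem part2 {v : M ⊗[K] M →ₗ[K] K} (hv : IsCyclic Coalgebra.comul v)
    {db : A →ₗ[K] A →ₗ[K] A ⊗[K] A}
    {ρ : A →ₗ[K] M →ₗ[K] R}
    (hgen : Algebra.adjoin K {x : R | ∃ (a : A) (α : M), ρ a α = x} = ⊤)
    {br : R →ₗ[K] R →ₗ[K] R} (hanti : ∀ x y : R, br x y = - br y x)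
    (hleib : ∀ x y z : R, br x (y * z) = br x y * z + y * br x z)
    (hfor : BrFormula Coalgebra.comul v db ρ br)
    (φ : M →ₗ[K] K) (D : R →ₗ[K] R)
    (hD : ∀ (x y : R), D (x * y) = D x * y + x * D y)
    (hDgen : ∀ (a : A) (α : M), D (ρ a α) = ρ a (innerCoder Coalgebra.comul φ α))
    (x y : R) : D (br x y) = br (D x) y + br x (D y) := by
  let Q (x : R) : R →ₗ[K] R := D ∘ₗ br x - br (D x) - br x ∘ₗ D
  have hQ (x y : R) : Q x y = D (br x y) - br (D x) y - br x (D y) := rfl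
  have hQd (x y z : R) : Q x (y * z) = Q x y * z + y * Q x z := by
    simp only [hQ, hleib, hD, map_add]; ring
  have hQa (x y : R) : Q x y = - Q y x := by
    simp only [hQ]
    rw [hanti x y, hanti (D x) y, hanti x (D y), map_neg]; ring
  have h0 : ∀ x y : R, (0 : R →ₗ[K] R) (x * y) = (0 : R →ₗ[K] R) x * y + x * (0 : R →ₗ[K] R) y := by
    simp
  have hrc (b : A) : dc D (rc ρ b) = rc ρ b * emb R φ - emb R φ * rc ρ b := by
    ext β
    rw [← emb_comm]
    exact hDgen b β
  have hab (a b : A) (α β : M) : Q (ρ a α) (ρ b β) = 0 := by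
    have hB := hleib (ρ a α)
    have e1 : D (br (ρ a α) (ρ b β)) = dc D (Phi2 ρ (V R v α) (db a b)) β := by
      rw [← dc_br hfor]; rfl
    have e2 : br (D (ρ a α)) (ρ b β) =
        Phi2 ρ (V R v (innerCoder Coalgebra.comul φ α)) (db a b) β := by
      rw [← dc_br hfor, hDgen]; rfl
    have e3 : br (ρ a α) (D (ρ b β)) = (Phi2 ρ (V R v α) (db a b) * emb R φ -
        emb R φ * Phi2 ρ (V R v α) (db a b)) β := by
      have : br (ρ a α) (D (ρ b β)) = dc (br (ρ a α)) (dc D (rc ρ b)) β := rfl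
      rw [this, hrc, dc_sub, dc_mul hB, dc_mul hB, dc_emb hB, dc_br hfor, mul_zero, zero_mul,
        add_zero, zero_add]
    rw [hQ, e1, e2, e3, V_coder hv]
    suffices h : ∀ t, dc D (Phi2 ρ (V R v α) t) -
        Phi2 ρ (emb R φ * V R v α - V R v α * emb R φ) t -
        (Phi2 ρ (V R v α) t * emb R φ - emb R φ * Phi2 ρ (V R v α) t) = 0 by
      exact congrArg (fun f => f β) (h (db a b))
    intro t
    induction t with
    | zero => ext; simp [dc]
    | add p q hp hq =>
      rw [map_add, map_add, dc_add, ← add_zero (0 : WithConv (M →ₗ[K] R))]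
      nth_rw 1 [← hp]
      rw [← hq]
      noncomm_ring
    | tmul x y =>
      rw [Phi2_tmul, Phi2_tmul, dc_mul hD, dc_mul hD, hrc, hrc]
      have : dc D (V R v α) = 0 := dc_emb hD _
      rw [this]
      noncomm_ring
  have hb (b : A) (β : M) : Q (ρ b β) = 0 := der_ext hgen (hQd _) h0 fun a α => hab _ _ _ _
  have : Q x = 0 := der_ext hgen (hQd _) h0 fun b β => by rw [hQa, hb]; simp
  have := LinearMap.congr_fun this y
  rw [hQ, LinearMap.zero_apply] at this
  linear_combination this

end

end PGaux

/-- for a double quasi-Poisson bracket on a unital algebra `A` (concentrated in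
degree zero) and a cyclic bilinear form `v` on a counital coalgebra `M`, the Jacobi form of
the induced bracket `⟨−,−⟩_v⁺` on `A_M⁺` vanishes on `E × A_M⁺ × A_M⁺`, where
`E = (A_M⁺)^{M̲*}`; in particular `E` is closed under the bracket and `(E, ⟨−,−⟩_v⁺)` is a
Poisson algebra. -/
theorem statement_19 {K A M R : Type} [CommRing K]
    [Ring A] [Algebra K A]
    [AddCommGroup M] [Module K M] (μ : M →ₗ[K] M ⊗[K] M) (hμ : PG.Coassoc μ)
    (ε : M →ₗ[K] K) (hε : PG.IsCounit μ ε)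
    (v : M ⊗[K] M →ₗ[K] K) (hv : PG.IsCyclic μ v)
    (db : A →ₗ[K] A →ₗ[K] A ⊗[K] A) (hdb : PG.IsDoubleBracket₀ db)
    (hqp : PG.IsQuasiPoisson db)
    [CommRing R] [Algebra K R]
    (ρ : A →ₗ[K] M →ₗ[K] R) (hrep : PG.IsRepAlgebraPlus₀ μ ε ρ)
    (br : R →ₗ[K] R →ₗ[K] R)
    (hanti : ∀ x y : R, br x y = - br y x)
    (hleib : ∀ x y z : R, br x (y * z) = br x y * z + y * br x z)
    (hfor : PG.BrFormula μ v db ρ br)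
    (Dfam : (M →ₗ[K] K) → R →ₗ[K] R)
    (hDder : ∀ (φ : M →ₗ[K] K) (x y : R), Dfam φ (x * y) = Dfam φ x * y + x * Dfam φ y)
    (hDgen : ∀ (φ : M →ₗ[K] K) (a : A) (α : M), Dfam φ (ρ a α) = ρ a (PG.innerCoder μ φ α)) :
    (∀ x : R, (∀ φ : M →ₗ[K] K, Dfam φ x = 0) → ∀ y z : R,
      br x (br y z) + br y (br z x) + br z (br x y) = 0) ∧
    (∀ x y : R, (∀ φ : M →ₗ[K] K, Dfam φ x = 0) → (∀ φ : M →ₗ[K] K, Dfam φ y = 0) →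
      ∀ φ : M →ₗ[K] K, Dfam φ (br x y) = 0) := by
  letI : Coalgebra K M :=
    { comul := μ
      counit := ε
      coassoc := hμ
      rTensor_counit_comp_comul := by
        ext α
        apply (TensorProduct.lid K M).injective
        simpa using (hε α).1
      lTensor_counit_comp_comul := by
        ext α
        apply (TensorProduct.rid K M).injective
        simpa using (hε α).2 }
  refine ⟨fun x hx y z => ?_, fun x y hx hy φ => ?_⟩
  · exact PGaux.part1 hv hdb hqp hrep.mul_rel hrep.norm_rel hrep.gen_rel hanti hleib hfor
      Dfam hDder hDgen x hx y z
  · rw [PGaux.part2 hv hrep.gen_rel hanti hleib hfor φ (Dfam φ) (hDder φ) (hDgen φ) x y,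
      hx φ, hy φ]
    simp
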